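/- Let Γ be a finite simple graph on at most 15 vertices whose automorphism group is isomorphic to the alternating group A₄, and let A₄ act on the vertex set V(Γ) via a fixed isomorphism A₄ ≅ Aut(Γ). Then no orbit of this action has size 4, and no orbit has size 12. -/

import Mathlib

/-- The orbit of a vertex `v` under the action of `G` on the vertices of `Γ`
induced by an isomorphism `e : G ≃* Aut(Γ)`. -/
def autOrbit {G V : Type*} [Group G] {Γ : SimpleGraph V}
    (e : G ≃* (Γ ≃g Γ)) (v : V) : Set V :=
  Set.range fun g : G => e g v

namespace A4Graph

open Equiv MulAction

/-- The alternating group `A₄`. -/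
abbrev A4 := alternatingGroup (Fin 4)

/-- The automorphism of `A₄` given by conjugation with a permutation in `S₄`. -/
def twist (τ : Perm (Fin 4)) : A4 ≃* A4 := MulAut.conjNormal τ

/-- The 3-cycle `(0 1 2)`. -/
def rot : A4 := ⟨swap 0 1 * swap 1 2, Perm.mem_alternatingGroup.2 (by decide)⟩

/-- The double transposition `(0 1)(2 3)`. -/
def dbl : A4 := ⟨swap 0 1 * swap 2 3, Perm.mem_alternatingGroup.2 (by decide)⟩

/-- Membership in the Klein four-group, the point stabilizer of the orbit of size 3. -/
def InKlein (g : A4) : Prop := g * g = 1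

/-- Membership in the stabilizer of the letter `3`. -/
def FixesThree (g : A4) : Prop := g.1 3 = 3

/-- Membership in the subgroup generated by `dbl`. -/
def InDbl (g : A4) : Prop := g = 1 ∨ g = dbl

instance : DecidablePred InKlein := fun g => inferInstanceAs (Decidable (g * g = 1))
instance : DecidablePred FixesThree := fun g => inferInstanceAs (Decidable (g.1 3 = 3))
instance : DecidablePred InDbl := fun g => inferInstanceAs (Decidable (g = 1 ∨ g = dbl))

theorem inKlein_twist : ∀ τ g, InKlein (twist τ g) ↔ InKlein g := by decide +kernel

theorem eq_one_of_twist_eq_self : ∀ τ, (∀ g, twist τ g = g) → τ = 1 := by decide +kernel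

/-! ### Inverse-closed subsets of `A₄` -/

theorem exists_perm_preserving : ∀ b a : Fin 4 → Bool, ∃ τ : Perm (Fin 4), τ ≠ 1 ∧
    (∀ i, b (τ i) = b i) ∧ ∀ g : A4, InKlein g → a ((twist τ g).1 3) = a (g.1 3) := by
  decide +kernel

/-- Every inverse-closed subset of `A₄` is preserved by conjugation with a nontrivial
permutation in `S₄`. -/
theorem exists_twist_preserving (f : A4 → Prop) (hf : ∀ g, f g⁻¹ ↔ f g) :
    ∃ τ : Perm (Fin 4), τ ≠ 1 ∧ ∀ g, f (twist τ g) ↔ f g := by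
  classical
  have h₁ : ∀ i : Fin 4, ∃ c : A4, ∀ g : A4, ¬ InKlein g → g.1 i = i → g = c ∨ g = c⁻¹ := by
    decide +kernel
  have h₂ : ∀ j : Fin 4, ∃ d : A4, ∀ g : A4, InKlein g → g.1 3 = j → g = d := by
    decide +kernel
  have h₃ : ∀ g : A4, ¬ InKlein g → ∃ i, g.1 i = i := by decide +kernel
  choose c hc using h₁
  choose d hd using h₂
  obtain ⟨τ, hτ, hb, ha⟩ :=
    exists_perm_preserving (fun i => decide (f (c i))) (fun j => decide (f (d j)))
  simp only [decide_eq_decide] at hb ha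
  have key : ∀ g i, ¬ InKlein g → g.1 i = i → (f g ↔ f (c i)) := by
    intro g i hg hi
    obtain h | h := hc i g hg hi
    · rw [h]
    · rw [h, hf]
  refine ⟨τ, hτ, fun g => ?_⟩
  by_cases hg : InKlein g
  · have := ha g hg
    rwa [← hd _ _ ((inKlein_twist τ g).2 hg) rfl, ← hd _ g hg rfl] at this
  · obtain ⟨i, hi⟩ := h₃ g hg
    have hi' : (twist τ g).1 (τ i) = τ i := by
      simp [twist, MulAut.conjNormal_apply, hi]
    rw [key _ _ (fun h => hg ((inKlein_twist τ g).1 h)) hi', key g i hg hi, hb]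

/-! ### Stabilizers and orbits -/

variable {V : Type*} [MulAction A4 V]

/-- The stabilizer of `v` consists of the elements satisfying `K`. -/
def HasStab (v : V) (K : A4 → Prop) : Prop := ∀ g : A4, g • v = v ↔ K g

theorem HasStab.smul_eq_smul {v : V} {K : A4 → Prop} (h : HasStab v K) {g g' : A4} :
    g • v = g' • v ↔ K (g'⁻¹ * g) := by
  rw [← h, mul_smul, inv_smul_eq_iff]

theorem HasStab.ncard_orbit {v : V} {K : A4 → Prop} (h : HasStab v K) :
    (orbit A4 v).ncard * Nat.card {g // K g} = 12 := by
  have h₁ := (stabilizer A4 v).index_mul_card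
  have h₂ : Nat.card (stabilizer A4 v) = Nat.card {g // K g} :=
    Nat.card_congr (Equiv.subtypeEquivRight h)
  have h₃ : Nat.card A4 = 12 := by
    rw [Nat.card_eq_fintype_card]; decide +kernel
  rwa [index_stabilizer, h₂, h₃] at h₁

theorem HasStab.ncard_orbit_fixed {v : V} (h : HasStab v fun _ => True) :
    (orbit A4 v).ncard = 1 := by
  have h₁ := h.ncard_orbit
  have h₂ : Nat.card {g : A4 // True} = 12 := by
    rw [Nat.card_eq_fintype_card]; decide +kernel
  lia

theorem HasStab.ncard_orbit_inKlein {v : V} (h : HasStab v InKlein) :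
    (orbit A4 v).ncard = 3 := by
  have h₁ := h.ncard_orbit
  have h₂ : Nat.card {g // InKlein g} = 4 := by
    rw [Nat.card_eq_fintype_card]; decide +kernel
  lia

theorem HasStab.ncard_orbit_fixesThree {v : V} (h : HasStab v FixesThree) :
    (orbit A4 v).ncard = 4 := by
  have h₁ := h.ncard_orbit
  have h₂ : Nat.card {g // FixesThree g} = 3 := by
    rw [Nat.card_eq_fintype_card]; decide +kernel
  lia

theorem HasStab.ncard_orbit_inDbl {v : V} (h : HasStab v InDbl) :
    (orbit A4 v).ncard = 6 := by
  have h₁ := h.ncard_orbit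
  have h₂ : Nat.card {g // InDbl g} = 2 := by
    rw [Nat.card_eq_fintype_card]; decide +kernel
  lia

theorem HasStab.ncard_orbit_free {v : V} (h : HasStab v (· = 1)) :
    (orbit A4 v).ncard = 12 := by
  have h₁ := h.ncard_orbit
  simpa using h₁

theorem hasStab_of_rot_smul {v : V} (h : rot • v = v) :
    HasStab v FixesThree ∨ HasStab v fun _ => True := by
  have h₁ : ∀ g, FixesThree g → g = 1 ∨ g = rot ∨ g = rot⁻¹ := by decide +kernel
  have h₂ : ∀ x, ¬ FixesThree x → ∀ g, ∃ a b, FixesThree a ∧ FixesThree b ∧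
      (g = a ∨ g = a * x * b) := by decide +kernel
  have h₃ : ∀ g, FixesThree g → g • v = v := by
    intro g hg
    obtain rfl | rfl | rfl := h₁ g hg
    · simp
    · exact h
    · rw [inv_smul_eq_iff, h]
  by_cases hx : ∃ x : A4, x • v = v ∧ ¬ FixesThree x
  · right
    obtain ⟨x, hxv, hx⟩ := hx
    refine fun g => iff_of_true ?_ trivial
    obtain ⟨a, b, ha, hb, rfl | rfl⟩ := h₂ x hx g
    · exact h₃ _ ha
    · rw [mul_smul, mul_smul, h₃ b hb, hxv, h₃ a ha]
  · left
    push Not at hx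
    exact fun g => ⟨hx g, h₃ g⟩

theorem hasStab_of_dbl_smul {v : V} (h : dbl • v = v) (hK : ∀ g : A4, g • v = v → InKlein g) :
    HasStab v InDbl ∨ HasStab v InKlein := by
  have h₁ : ∀ x, InKlein x → ¬ InDbl x → ∀ g, InKlein g →
      g = 1 ∨ g = dbl ∨ g = x ∨ g = dbl * x := by decide +kernel
  by_cases hx : ∃ x : A4, x • v = v ∧ ¬ InDbl x
  · right
    obtain ⟨x, hxv, hx⟩ := hx
    refine fun g => ⟨hK g, fun hg => ?_⟩
    obtain rfl | rfl | rfl | rfl := h₁ x (hK x hxv) hx g hg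
    · simp
    · exact h
    · exact hxv
    · rw [mul_smul, hxv, h]
  · left
    push Not at hx
    refine fun g => ⟨hx g, ?_⟩
    rintro (rfl | rfl)
    · simp
    · exact h

theorem smul_smul_eq_iff (k g : A4) (v : V) : g • k • v = k • v ↔ (k⁻¹ * g * k) • v = v := by
  rw [mul_assoc, mul_smul, inv_smul_eq_iff, mul_smul]

/-- Up to conjugation, the point stabilizers are the subgroups of `A₄` of order 12, 4, 3, 2, 1. -/
theorem exists_hasStab (v : V) : ∃ k : A4, HasStab (k • v) (fun _ => True) ∨
    HasStab (k • v) InKlein ∨ HasStab (k • v) FixesThree ∨ HasStab (k • v) InDbl ∨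
    HasStab (k • v) (· = 1) := by
  by_cases hK : ∀ g : A4, g • v = v → InKlein g
  · by_cases h1 : ∃ g : A4, g • v = v ∧ g ≠ 1
    · obtain ⟨g, hg, hg1⟩ := h1
      have h₁ : ∀ g, InKlein g → g ≠ 1 → ∃ k, k⁻¹ * dbl * k = g := by decide +kernel
      have h₂ : ∀ k g, InKlein (k⁻¹ * g * k) → InKlein g := by decide +kernel
      obtain ⟨k, hk⟩ := h₁ g (hK g hg) hg1
      have := hasStab_of_dbl_smul (v := k • v) ((smul_smul_eq_iff _ _ _).2 (by rw [hk, hg]))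
        fun x hx => h₂ k x (hK _ ((smul_smul_eq_iff _ _ _).1 hx))
      exact ⟨k, .inr (this.elim (fun h => .inr (.inr (.inl h))) .inl)⟩
    · push Not at h1
      refine ⟨1, ?_⟩
      rw [one_smul]
      refine .inr (.inr (.inr (.inr fun g => ⟨h1 g, ?_⟩)))
      rintro rfl
      simp
  · push Not at hK
    obtain ⟨g, hg, hgK⟩ := hK
    have h₁ : ∀ g, ¬ InKlein g → ∃ k, k⁻¹ * rot * k = g ∨ k⁻¹ * rot * k = g⁻¹ := by
      decide +kernel
    obtain ⟨k, hk⟩ := h₁ g hgK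
    have := hasStab_of_rot_smul (v := k • v) ((smul_smul_eq_iff _ _ _).2 (by
      obtain hk | hk := hk
      · rw [hk, hg]
      · rw [hk, inv_smul_eq_iff, hg]))
    exact ⟨k, this.elim (fun h => .inr (.inr (.inl h))) .inl⟩

theorem ncard_orbit_smul (k : A4) (v : V) : (orbit A4 (k • v)).ncard = (orbit A4 v).ncard := by
  rw [orbit_smul]

theorem disjoint_orbit {v w : V} (h : ∀ g : A4, g • v ≠ w) :
    Disjoint (orbit A4 v) (orbit A4 w) := by
  refine (orbit.eq_or_disjoint v w).resolve_left fun hvw => ?_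
  obtain ⟨g, hg⟩ : w ∈ orbit A4 v := hvw ▸ mem_orbit_self w
  exact h g hg

theorem sum_ncard_orbit_le [Finite V] {l : List V}
    (hl : l.Pairwise fun v w => ∀ g : A4, g • v ≠ w) :
    (l.map fun v => (orbit A4 v).ncard).sum ≤ Nat.card V := by
  have : (l.map fun v => (orbit A4 v).ncard).sum = (⋃ v ∈ l, orbit A4 v).ncard := by
    induction l with
    | nil => simp
    | cons v l ih =>
      rw [List.pairwise_cons] at hl
      have hd : Disjoint (orbit A4 v) (⋃ w ∈ l, orbit A4 w) := by
        simp only [Set.disjoint_iUnion_right]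
        exact fun w hw => disjoint_orbit (hl.1 w hw)
      simp only [List.map_cons, List.sum_cons, List.mem_cons, Set.iUnion_iUnion_eq_or_left]
      rw [ih hl.2, Set.ncard_union_eq hd]
  exact this ▸ Set.ncard_le_card _

theorem ncard_orbit_add_le [Finite V] {v w : V} (h : ∀ g : A4, g • v ≠ w) :
    (orbit A4 v).ncard + (orbit A4 w).ncard ≤ Nat.card V := by
  simpa using sum_ncard_orbit_le (l := [v, w]) (by simpa using h)

theorem ncard_orbit_add_add_le [Finite V] {u v w : V} (h₁ : ∀ g : A4, g • u ≠ v)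
    (h₂ : ∀ g : A4, g • u ≠ w) (h₃ : ∀ g : A4, g • v ≠ w) :
    (orbit A4 u).ncard + (orbit A4 v).ncard + (orbit A4 w).ncard ≤ Nat.card V := by
  have := sum_ncard_orbit_le (l := [u, v, w])
    (.cons (List.forall_mem_cons.2 ⟨h₁, List.forall_mem_singleton.2 h₂⟩)
      (.cons (List.forall_mem_singleton.2 h₃) (List.pairwise_singleton _ _)))
  simpa [add_assoc] using this

/-- A set of orbit representatives. -/
structure IsTransversal (R : Set V) : Prop where
  exists_smul : ∀ v, ∃ r ∈ R, ∃ g : A4, g • r = v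
  eq_of_smul : ∀ r ∈ R, ∀ s ∈ R, ∀ g : A4, g • r = s → r = s

theorem exists_isTransversal (P : V → Prop) (hP : ∀ v, ∃ g : A4, P (g • v)) :
    ∃ R : Set V, IsTransversal R ∧ ∀ r ∈ R, P r := by
  choose f hf using hP
  let ρ : orbitRel.Quotient A4 V → V := fun q => f q.out • q.out
  have hρ : ∀ q, (Quotient.mk _ (ρ q) : orbitRel.Quotient A4 V) = q := by
    intro q
    conv_rhs => rw [← q.out_eq]
    exact Quotient.sound ⟨f q.out, rfl⟩
  refine ⟨Set.range ρ, ⟨fun v => ?_, ?_⟩, ?_⟩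
  · refine ⟨_, ⟨Quotient.mk _ v, rfl⟩, ?_⟩
    obtain ⟨g, hg⟩ : v ∈ orbit A4 (ρ (Quotient.mk _ v)) :=
      orbitRel_apply.1 (Quotient.exact (hρ (Quotient.mk _ v)).symm)
    exact ⟨g, hg⟩
  · rintro _ ⟨p, rfl⟩ _ ⟨q, rfl⟩ g hg
    have hpq : ρ q ∈ orbit A4 (ρ p) := ⟨g, hg⟩
    have : (Quotient.mk _ (ρ q) : orbitRel.Quotient A4 V) = Quotient.mk _ (ρ p) :=
      Quotient.sound (orbitRel_apply.2 hpq)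
    rw [hρ, hρ] at this
    rw [this]
  · rintro _ ⟨q, rfl⟩
    exact hf _

/-! ### Twisted-equivariant automorphisms -/

/-- `A₄` acts on `Γ` by automorphisms, and every automorphism arises in this way. -/
structure IsFullAut (Γ : SimpleGraph V) : Prop where
  adj_smul : ∀ (g : A4) x y, Γ.Adj (g • x) (g • y) ↔ Γ.Adj x y
  exists_smul : ∀ σ : V ≃ V, (∀ x y, Γ.Adj (σ x) (σ y) ↔ Γ.Adj x y) →
    ∃ g : A4, ∀ v, g • v = σ v

/-- The maps `g • r ↦ twist τ g • r` and `h • s ↦ twist τ' h • s` preserve adjacency between the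
orbits of `r` and `s`. -/
def TwistInv (Γ : SimpleGraph V) (τ τ' : Perm (Fin 4)) (r s : V) : Prop :=
  ∀ g h : A4, Γ.Adj (twist τ g • r) (twist τ' h • s) ↔ Γ.Adj (g • r) (h • s)

variable {Γ : SimpleGraph V}

theorem TwistInv.symm {τ τ' : Perm (Fin 4)} {r s : V} (h : TwistInv Γ τ τ' r s) :
    TwistInv Γ τ' τ s r := fun a b => by rw [Γ.adj_comm, h, Γ.adj_comm]

theorem IsFullAut.exists_smul_eq_twist [Finite V] (hΓ : IsFullAut Γ) {R : Set V}
    (hR : IsTransversal R) (τ : V → Perm (Fin 4))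
    (hstab : ∀ r ∈ R, ∀ g : A4, twist (τ r) g • r = r ↔ g • r = r)
    (hadj : ∀ r ∈ R, ∀ s ∈ R, TwistInv Γ (τ r) (τ s) r s) :
    ∃ k : A4, ∀ r ∈ R, ∀ g : A4, k • g • r = twist (τ r) g • r := by
  choose ρ hρR γ hγ using hR.exists_smul
  have hstab' : ∀ r ∈ R, ∀ g h : A4, twist (τ r) g • r = twist (τ r) h • r ↔ g • r = h • r := by
    intro r hr g h
    rw [← inv_smul_eq_iff, ← map_inv, ← mul_smul, ← map_mul, hstab r hr, mul_smul,
      inv_smul_eq_iff]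
  let σ : V → V := fun v => twist (τ (ρ v)) (γ v) • ρ v
  have hρ : ∀ r ∈ R, ∀ g : A4, ρ (g • r) = r := fun r hr g =>
    hR.eq_of_smul _ (hρR _) _ hr (g⁻¹ * γ (g • r)) (by rw [mul_smul, hγ, inv_smul_smul])
  have hσ : ∀ r ∈ R, ∀ g : A4, σ (g • r) = twist (τ r) g • r := by
    intro r hr g
    have h := hγ (g • r)
    simp only [σ]
    rw [hρ r hr] at h ⊢
    exact (hstab' r hr _ _).2 h
  have hinj : Function.Injective σ := by
    intro v w hvw
    have h : ρ v = ρ w := by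
      refine hR.eq_of_smul _ (hρR v) _ (hρR w)
        ((twist (τ (ρ w)) (γ w))⁻¹ * twist (τ (ρ v)) (γ v)) ?_
      rw [mul_smul, inv_smul_eq_iff]
      exact hvw
    simp only [σ, h] at hvw
    rw [hstab' _ (hρR w)] at hvw
    rw [← hγ v, ← hγ w, h, hvw]
  obtain ⟨k, hk⟩ := hΓ.exists_smul (Equiv.ofBijective σ (Finite.injective_iff_bijective.1 hinj))
    fun x y => by
      rw [← hγ x, ← hγ y]
      simp only [Equiv.ofBijective_apply]
      rw [hσ _ (hρR x), hσ _ (hρR y), hadj _ (hρR x) _ (hρR y)]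
  exact ⟨k, fun r hr g => by rw [hk, Equiv.ofBijective_apply, hσ r hr]⟩

theorem IsFullAut.adj_iff_of_smul (hΓ : IsFullAut Γ) {x y x' y' : V}
    (h : ∃ k : A4, k • x = x' ∧ k • y = y') : Γ.Adj x' y' ↔ Γ.Adj x y := by
  obtain ⟨k, rfl, rfl⟩ := h
  exact hΓ.adj_smul k x y

theorem IsFullAut.adj_smul_smul (hΓ : IsFullAut Γ) (g h : A4) (r s : V) :
    Γ.Adj (g • r) (h • s) ↔ Γ.Adj r ((g⁻¹ * h) • s) := by
  rw [← hΓ.adj_smul g r, mul_smul, smul_inv_smul]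

theorem IsFullAut.twistInv (hΓ : IsFullAut Γ) {τ : Perm (Fin 4)} {r s : V}
    (h : ∀ g : A4, Γ.Adj r (twist τ g • s) ↔ Γ.Adj r (g • s)) : TwistInv Γ τ τ r s := by
  intro g g'
  rw [hΓ.adj_smul_smul, ← map_inv, ← map_mul, h, ← hΓ.adj_smul_smul]

theorem IsFullAut.twistInv_of_hasStab (hΓ : IsFullAut Γ) {τ τ' : Perm (Fin 4)} {r s : V}
    {K L : A4 → Prop} (hr : HasStab r K) (hs : HasStab s L)
    (h : ∀ g g', ∃ k, K ((twist τ g)⁻¹ * k * g) ∧ L ((twist τ' g')⁻¹ * k * g')) :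
    TwistInv Γ τ τ' r s := by
  intro g g'
  obtain ⟨k, h₁, h₂⟩ := h g g'
  refine hΓ.adj_iff_of_smul ⟨k, ?_, ?_⟩
  · rwa [← mul_smul, hr.smul_eq_smul, ← mul_assoc]
  · rwa [← mul_smul, hs.smul_eq_smul, ← mul_assoc]

theorem IsFullAut.twistInv_of_hasStab_left (hΓ : IsFullAut Γ) {τ : Perm (Fin 4)} {r s : V}
    {K L : A4 → Prop} (hr : HasStab r K) (hs : HasStab s L)
    (h : ∀ g, ∃ k, K k ∧ L ((twist τ g)⁻¹ * k * g)) : TwistInv Γ τ τ r s := by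
  refine hΓ.twistInv fun g => ?_
  obtain ⟨k, h₁, h₂⟩ := h g
  refine hΓ.adj_iff_of_smul ⟨k, (hr k).2 h₁, ?_⟩
  rwa [← mul_smul, hs.smul_eq_smul, ← mul_assoc]

theorem IsFullAut.twistInv_self (hΓ : IsFullAut Γ) {τ : Perm (Fin 4)} {r : V}
    {K : A4 → Prop} (hr : HasStab r K)
    (h : ∀ g, ∃ k, K ((twist τ g)⁻¹ * k) ∧ K (k * g) ∨ K k ∧ K ((twist τ g)⁻¹ * k * g)) :
    TwistInv Γ τ τ r r := by
  refine hΓ.twistInv fun g => ?_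
  obtain ⟨k, ⟨h₁, h₂⟩ | ⟨h₁, h₂⟩⟩ := h g
  · rw [Γ.adj_comm r (g • r)]
    refine hΓ.adj_iff_of_smul ⟨k, ?_, hr.smul_eq_smul.2 h₁⟩
    rwa [← mul_smul, hr]
  · refine hΓ.adj_iff_of_smul ⟨k, (hr k).2 h₁, ?_⟩
    rwa [← mul_smul, hr.smul_eq_smul, ← mul_assoc]

theorem IsFullAut.twistInv_fixed (hΓ : IsFullAut Γ) (τ τ' : Perm (Fin 4)) {r : V} (s : V)
    (hr : HasStab r fun _ => True) : TwistInv Γ τ τ' r s := by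
  intro g h
  refine hΓ.adj_iff_of_smul ⟨twist τ' h * h⁻¹, ?_, ?_⟩
  · rw [(hr _).2 trivial, (hr _).2 trivial, (hr _).2 trivial]
  · rw [mul_smul, inv_smul_smul]

theorem IsFullAut.twistInv_inKlein_self (hΓ : IsFullAut Γ) (τ : Perm (Fin 4)) {r : V}
    (hr : HasStab r InKlein) : TwistInv Γ τ τ r r := by
  have : ∀ τ g, ∃ k, InKlein ((twist τ g)⁻¹ * k) ∧ InKlein (k * g) ∨
      InKlein k ∧ InKlein ((twist τ g)⁻¹ * k * g) := by decide +kernel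
  exact hΓ.twistInv_self hr (this τ)

theorem IsFullAut.twistInv_inDbl_self (hΓ : IsFullAut Γ) {r : V}
    (hr : HasStab r InDbl) : TwistInv Γ (swap 0 1) (swap 0 1) r r :=
  hΓ.twistInv_self hr (by decide +kernel)

theorem IsFullAut.twistInv_fixesThree (hΓ : IsFullAut Γ) {r s : V}
    (hr : HasStab r FixesThree) (hs : HasStab s FixesThree) :
    TwistInv Γ (swap 0 1) (swap 0 1) r s :=
  hΓ.twistInv_of_hasStab hr hs (by decide +kernel)

theorem IsFullAut.twistInv_inKlein_fixesThree (hΓ : IsFullAut Γ) {r s : V}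
    (hr : HasStab r InKlein) (hs : HasStab s FixesThree) :
    TwistInv Γ (swap 0 1) (swap 0 1) r s :=
  hΓ.twistInv_of_hasStab_left hr hs (by decide +kernel)

theorem IsFullAut.twistInv_one_inKlein_fixesThree (hΓ : IsFullAut Γ) {r s : V}
    (hr : HasStab r InKlein) (hs : HasStab s FixesThree) :
    TwistInv Γ 1 (swap 0 1) r s :=
  hΓ.twistInv_of_hasStab hr hs (by decide +kernel)

theorem IsFullAut.twistInv_inDbl_fixesThree (hΓ : IsFullAut Γ) {r s : V}
    (hr : HasStab r InDbl) (hs : HasStab s FixesThree) :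
    TwistInv Γ (swap 0 1) (swap 0 1) r s :=
  hΓ.twistInv_of_hasStab_left hr hs (by decide +kernel)

/-- The vertex `t` lies in an orbit of size 3, and `r` is adjacent to both or neither of the other
two vertices of this orbit. -/
def IsBalanced (Γ : SimpleGraph V) (r t : V) : Prop :=
  HasStab t InKlein ∧ ∀ g g' : A4, ¬ InKlein g → ¬ InKlein g' →
    (Γ.Adj r (g • t) ↔ Γ.Adj r (g' • t))

theorem exists_isBalanced (Γ : SimpleGraph V) (r : V) {t : V} (ht : HasStab t InKlein) :
    ∃ g : A4, IsBalanced Γ r (g • t) := by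
  have h₁ : ∀ g, ¬ InKlein g → ∃ v, InKlein v ∧ (g = rot * v ∨ g = rot⁻¹ * v) := by
    decide +kernel
  have h₂ : ∀ g v, InKlein (v⁻¹ * g * v) ↔ InKlein g := by decide +kernel
  have h₃ : rot * rot = rot⁻¹ := by decide +kernel
  have h₄ : rot⁻¹ * rot⁻¹ = rot := by decide +kernel
  have key : ∀ k : A4, (Γ.Adj r (rot • k • t) ↔ Γ.Adj r (rot⁻¹ • k • t)) →
      IsBalanced Γ r (k • t) := by
    intro k hk
    have hkt : HasStab (k • t) InKlein := fun g => by
      rw [smul_smul_eq_iff, ht, h₂]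
    have : ∀ g : A4, ¬ InKlein g → (Γ.Adj r (g • k • t) ↔ Γ.Adj r (rot • k • t)) := by
      intro g hg
      obtain ⟨v, hv, rfl | rfl⟩ := h₁ g hg
      · rw [mul_smul, (hkt v).2 hv]
      · rw [mul_smul, (hkt v).2 hv, hk]
    exact ⟨hkt, fun g g' hg hg' => by rw [this g hg, this g' hg']⟩
  by_contra! h
  have h1 := fun h' => h 1 (key 1 h')
  have h2 := fun h' => h rot (key rot h')
  have h3 := fun h' => h rot⁻¹ (key rot⁻¹ h')
  simp only [smul_smul, h₃, h₄, mul_one, mul_inv_cancel, inv_mul_cancel] at h1 h2 h3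
  clear key h h₁ h₂ h₃ h₄
  tauto

theorem IsFullAut.twistInv_of_isBalanced (hΓ : IsFullAut Γ) (τ : Perm (Fin 4)) {r t : V}
    (h : IsBalanced Γ r t) : TwistInv Γ τ τ r t := by
  refine hΓ.twistInv fun g => ?_
  by_cases hg : InKlein g
  · rw [(h.1 _).2 hg, (h.1 _).2 ((inKlein_twist τ g).2 hg)]
  · exact h.2 _ _ (fun h' => hg ((inKlein_twist τ g).1 h')) hg

theorem hasStab_inKlein_twist (τ : Perm (Fin 4)) {r : V} (h : HasStab r InKlein) (g : A4) :
    twist τ g • r = r ↔ g • r = r := by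
  rw [h, h, inKlein_twist]

theorem hasStab_fixed_twist (τ : Perm (Fin 4)) {r : V} (h : HasStab r fun _ => True) (g : A4) :
    twist τ g • r = r ↔ g • r = r := by
  rw [h, h]

theorem hasStab_fixesThree_twist {r : V} (h : HasStab r FixesThree) (g : A4) :
    twist (swap 0 1) g • r = r ↔ g • r = r := by
  have : ∀ g, FixesThree (twist (swap 0 1) g) ↔ FixesThree g := by decide +kernel
  rw [h, h, this]

theorem hasStab_inDbl_twist {r : V} (h : HasStab r InDbl) (g : A4) :
    twist (swap 0 1) g • r = r ↔ g • r = r := by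
  have : ∀ g, InDbl (twist (swap 0 1) g) ↔ InDbl g := by decide +kernel
  rw [h, h, this]

theorem not_smul_eq_twist_of_fixesThree {r : V} (h : HasStab r FixesThree) (k : A4) :
    ¬ ∀ g : A4, k • g • r = twist (swap 0 1) g • r := by
  have : ¬ ∃ k, ∀ g, FixesThree ((twist (swap 0 1) g)⁻¹ * k * g) := by decide +kernel
  exact fun hk => this ⟨k, fun g => by rw [mul_assoc, ← h.smul_eq_smul, mul_smul, hk]⟩

/-! ### Excluding the orbit sizes -/

theorem IsFullAut.ncard_orbit_ne_twelve [Finite V] (hΓ : IsFullAut Γ) (hV : Nat.card V ≤ 15)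
    (v : V) : (orbit A4 v).ncard ≠ 12 := by
  intro hv
  obtain ⟨r, hr⟩ : ∃ r : V, HasStab r (· = 1) := by
    obtain ⟨k, h⟩ := exists_hasStab v
    rw [← ncard_orbit_smul k] at hv
    obtain h | h | h | h | h := h
    · have := h.ncard_orbit_fixed; lia
    · have := h.ncard_orbit_inKlein; lia
    · have := h.ncard_orbit_fixesThree; lia
    · have := h.ncard_orbit_inDbl; lia
    · exact ⟨_, h⟩
  have hr' := hr.ncard_orbit_free
  obtain ⟨τ, hτ, hS⟩ := exists_twist_preserving (fun g => Γ.Adj r (g • r)) fun g => by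
    rw [← hΓ.adj_smul g, smul_inv_smul, Γ.adj_comm]
  obtain ⟨R, hR, hRP⟩ := exists_isTransversal
    (fun w => w = r ∨ HasStab w (fun _ => True) ∨ IsBalanced Γ r w) fun w => by
      by_cases hw : ∃ g : A4, g • r = w
      · obtain ⟨g, rfl⟩ := hw
        exact ⟨g⁻¹, .inl (inv_smul_smul _ _)⟩
      · push Not at hw
        have hc := ncard_orbit_add_le hw
        obtain ⟨k, h⟩ := exists_hasStab w
        rw [← ncard_orbit_smul k w] at hc
        obtain h | h | h | h | h := h
        · exact ⟨k, .inr (.inl h)⟩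
        · obtain ⟨g, hg⟩ := exists_isBalanced Γ r h
          exact ⟨g * k, .inr (.inr (by rwa [mul_smul]))⟩
        · have := h.ncard_orbit_fixesThree; lia
        · have := h.ncard_orbit_inDbl; lia
        · have := h.ncard_orbit_free; lia
  have hrR : r ∈ R := by
    obtain ⟨s, hs, g, hg⟩ := hR.exists_smul r
    have hc := ncard_orbit_smul g s
    rw [hg, hr'] at hc
    obtain rfl | h | h := hRP s hs
    · exact hs
    · have := h.ncard_orbit_fixed; lia
    · have := h.1.ncard_orbit_inKlein; lia
  obtain ⟨k, hk⟩ := hΓ.exists_smul_eq_twist hR (fun _ => τ)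
    (by
      intro s hs g
      obtain rfl | h | h := hRP s hs
      · simp only [hr _, EmbeddingLike.map_eq_one_iff]
      · exact hasStab_fixed_twist τ h g
      · exact hasStab_inKlein_twist τ h.1 g)
    (by
      intro s hs t ht
      obtain rfl | h | h := hRP s hs <;> obtain rfl | h' | h' := hRP t ht
      · exact hΓ.twistInv hS
      · exact (hΓ.twistInv_fixed _ _ _ h').symm
      · exact hΓ.twistInv_of_isBalanced τ h'
      · exact hΓ.twistInv_fixed _ _ _ h
      · exact hΓ.twistInv_fixed _ _ _ h
      · exact hΓ.twistInv_fixed _ _ _ h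
      · exact (hΓ.twistInv_of_isBalanced τ h).symm
      · exact (hΓ.twistInv_fixed _ _ _ h').symm
      · obtain rfl | hst := eq_or_ne s t
        · exact hΓ.twistInv_inKlein_self τ h.1
        · have h₁ := h.1.ncard_orbit_inKlein
          have h₂ := h'.1.ncard_orbit_inKlein
          have := ncard_orbit_add_add_le (u := r) (v := s) (w := t)
            (fun g hg => by obtain rfl := hR.eq_of_smul _ hrR _ hs g hg; lia)
            (fun g hg => by obtain rfl := hR.eq_of_smul _ hrR _ ht g hg; lia)
            (fun g hg => hst (hR.eq_of_smul _ hs _ ht g hg))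
          lia)
  have hk' := hk r hrR
  have hk1 : k = 1 := by simpa [hr k] using hk' 1
  refine hτ (eq_one_of_twist_eq_self τ fun g => ?_)
  have := hk' g
  rw [hk1, one_smul, hr.smul_eq_smul, inv_mul_eq_one] at this
  exact this

theorem IsFullAut.ncard_orbit_ne_four [Finite V] (hΓ : IsFullAut Γ) (hV : Nat.card V ≤ 15)
    (v : V) : (orbit A4 v).ncard ≠ 4 := by
  intro hv
  have h12 := hΓ.ncard_orbit_ne_twelve hV
  have hclose : ∀ {R : Set V}, IsTransversal R → (∀ r ∈ R, (orbit A4 r).ncard = 4 →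
      HasStab r FixesThree) → ∃ r ∈ R, HasStab r FixesThree := by
    intro R hR hR4
    obtain ⟨s, hs, g, hg⟩ := hR.exists_smul v
    exact ⟨s, hs, hR4 s hs (by rw [← ncard_orbit_smul g, hg, hv])⟩
  by_cases h6 : ∃ r : V, HasStab r InDbl
  · obtain ⟨r, hr⟩ := h6
    have hr' := hr.ncard_orbit_inDbl
    have hrv : ∀ g : A4, g • r ≠ v := by
      rintro g rfl
      rw [ncard_orbit_smul] at hv
      lia
    obtain ⟨R, hR, hRP⟩ := exists_isTransversal (fun w => w = r ∨ HasStab w (fun _ => True) ∨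
      IsBalanced Γ r w ∨ HasStab w FixesThree) fun w => by
        by_cases hw : ∃ g : A4, g • r = w
        · obtain ⟨g, rfl⟩ := hw
          exact ⟨g⁻¹, .inl (inv_smul_smul _ _)⟩
        · push Not at hw
          obtain ⟨k, h⟩ := exists_hasStab w
          obtain h | h | h | h | h := h
          · exact ⟨k, .inr (.inl h)⟩
          · obtain ⟨g, hg⟩ := exists_isBalanced Γ r h
            exact ⟨g * k, .inr (.inr (.inl (by rwa [mul_smul])))⟩
          · exact ⟨k, .inr (.inr (.inr h))⟩
          · have h' := h.ncard_orbit_inDbl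
            rw [ncard_orbit_smul] at h'
            have := ncard_orbit_add_add_le hrv hw (by
              rintro g rfl
              rw [ncard_orbit_smul] at h'
              lia)
            lia
          · exact absurd h.ncard_orbit_free (h12 _)
    obtain ⟨s, hs, hs4⟩ := hclose hR fun s hs hs4 => by
      obtain rfl | h | h | h := hRP s hs
      · lia
      · have := h.ncard_orbit_fixed; lia
      · have := h.1.ncard_orbit_inKlein; lia
      · exact h
    have hrR : r ∈ R := by
      obtain ⟨s, hs, g, hg⟩ := hR.exists_smul r
      have hc := ncard_orbit_smul g s
      rw [hg, hr'] at hc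
      obtain rfl | h | h | h := hRP s hs
      · exact hs
      · have := h.ncard_orbit_fixed; lia
      · have := h.1.ncard_orbit_inKlein; lia
      · have := h.ncard_orbit_fixesThree; lia
    have hne : ∀ {a b : V}, a ∈ R → b ∈ R → a ≠ b → ∀ g : A4, g • a ≠ b :=
      fun ha hb hab g hg => hab (hR.eq_of_smul _ ha _ hb g hg)
    obtain ⟨k, hk⟩ := hΓ.exists_smul_eq_twist hR (fun _ => swap 0 1)
      (by
        intro s hs g
        obtain rfl | h | h | h := hRP s hs
        · exact hasStab_inDbl_twist hr g
        · exact hasStab_fixed_twist _ h g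
        · exact hasStab_inKlein_twist _ h.1 g
        · exact hasStab_fixesThree_twist h g)
      (by
        intro a ha b hb
        obtain rfl | h | h | h := hRP a ha <;> obtain rfl | h' | h' | h' := hRP b hb
        · exact hΓ.twistInv_inDbl_self hr
        · exact (hΓ.twistInv_fixed _ _ _ h').symm
        · exact hΓ.twistInv_of_isBalanced _ h'
        · exact hΓ.twistInv_inDbl_fixesThree hr h'
        · exact hΓ.twistInv_fixed _ _ _ h
        · exact hΓ.twistInv_fixed _ _ _ h
        · exact hΓ.twistInv_fixed _ _ _ h
        · exact hΓ.twistInv_fixed _ _ _ h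
        · exact (hΓ.twistInv_of_isBalanced _ h).symm
        · exact (hΓ.twistInv_fixed _ _ _ h').symm
        · obtain rfl | hab := eq_or_ne a b
          · exact hΓ.twistInv_inKlein_self _ h.1
          · have ha' := h.1.ncard_orbit_inKlein
            have hb' := h'.1.ncard_orbit_inKlein
            have hs' := hs4.ncard_orbit_fixesThree
            have hsa : s ≠ a := by rintro rfl; lia
            have hsb : s ≠ b := by rintro rfl; lia
            have hra : r ≠ a := by rintro rfl; lia
            have hrb : r ≠ b := by rintro rfl; lia
            have hrs : r ≠ s := by rintro rfl; lia
            have := sum_ncard_orbit_le (l := [r, s, a, b])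
              (.cons (List.forall_mem_cons.2 ⟨hne hrR hs hrs, List.forall_mem_cons.2
                  ⟨hne hrR ha hra, List.forall_mem_singleton.2 (hne hrR hb hrb)⟩⟩)
                (.cons (List.forall_mem_cons.2
                    ⟨hne hs ha hsa, List.forall_mem_singleton.2 (hne hs hb hsb)⟩)
                  (.cons (List.forall_mem_singleton.2 (hne ha hb hab))
                    (List.pairwise_singleton _ _))))
            simp only [List.map_cons, List.map_nil, List.sum_cons, List.sum_nil] at this
            lia
        · exact hΓ.twistInv_inKlein_fixesThree h.1 h'
        · exact (hΓ.twistInv_inDbl_fixesThree hr h).symm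
        · exact (hΓ.twistInv_fixed _ _ _ h').symm
        · exact (hΓ.twistInv_inKlein_fixesThree h'.1 h).symm
        · exact hΓ.twistInv_fixesThree h h')
    exact not_smul_eq_twist_of_fixesThree hs4 k (hk s hs)
  · push Not at h6
    obtain ⟨R, hR, hRP⟩ := exists_isTransversal (fun w : V => HasStab w (fun _ => True) ∨
      HasStab w InKlein ∨ HasStab w FixesThree) fun w => by
        obtain ⟨k, h | h | h | h | h⟩ := exists_hasStab w
        · exact ⟨k, .inl h⟩
        · exact ⟨k, .inr (.inl h)⟩
        · exact ⟨k, .inr (.inr h)⟩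
        · exact absurd h (h6 _)
        · exact absurd h.ncard_orbit_free (h12 _)
    obtain ⟨s, hs, hs4⟩ := hclose hR fun s hs hs4 => by
      obtain h | h | h := hRP s hs
      · have := h.ncard_orbit_fixed; lia
      · have := h.ncard_orbit_inKlein; lia
      · exact h
    let τ : V → Perm (Fin 4) := fun w => if (orbit A4 w).ncard = 4 then swap 0 1 else 1
    have hτ₄ : ∀ {w : V}, HasStab w FixesThree → τ w = swap 0 1 := fun h => by
      simp [τ, h.ncard_orbit_fixesThree]
    have hτ₃ : ∀ {w : V}, HasStab w InKlein → τ w = 1 := fun h => by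
      simp [τ, h.ncard_orbit_inKlein]
    obtain ⟨k, hk⟩ := hΓ.exists_smul_eq_twist hR τ
      (by
        intro s hs g
        obtain h | h | h := hRP s hs
        · exact hasStab_fixed_twist _ h g
        · exact hasStab_inKlein_twist _ h g
        · rw [hτ₄ h]
          exact hasStab_fixesThree_twist h g)
      (by
        intro a ha b hb
        obtain h | h | h := hRP a ha
        · exact hΓ.twistInv_fixed _ _ _ h
        all_goals obtain h' | h' | h' := hRP b hb
        · exact (hΓ.twistInv_fixed _ _ _ h').symm
        · rw [hτ₃ h, hτ₃ h']
          exact fun g g' => by simp [twist]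
        · rw [hτ₃ h, hτ₄ h']
          exact hΓ.twistInv_one_inKlein_fixesThree h h'
        · exact (hΓ.twistInv_fixed _ _ _ h').symm
        · rw [hτ₄ h, hτ₃ h']
          exact (hΓ.twistInv_one_inKlein_fixesThree h' h).symm
        · rw [hτ₄ h, hτ₄ h']
          exact hΓ.twistInv_fixesThree h h')
    have hk' := hk s hs
    rw [hτ₄ hs4] at hk'
    exact not_smul_eq_twist_of_fixesThree hs4 k hk'

end A4Graph

/-- Lemmas: if `A₄` acts on the vertices of a graph `Γ` with at most 15
vertices via an isomorphism `A₄ ≃* Aut(Γ)`, then no orbit has size 4 and no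
orbit has size 12. -/
theorem A4_no_orbit_of_size_four_or_twelve
    (V : Type*) [Fintype V] (hV : Nat.card V ≤ 15)
    (Γ : SimpleGraph V) (e : alternatingGroup (Fin 4) ≃* (Γ ≃g Γ)) :
    ∀ v : V, Nat.card (autOrbit e v) ≠ 4 ∧ Nat.card (autOrbit e v) ≠ 12 := by
  let _ : MulAction A4Graph.A4 V :=
    { smul := fun g v => e g v
      one_smul := fun v => by
        change e 1 v = v
        rw [map_one]
        rfl
      mul_smul := fun g h v => by
        change e (g * h) v = e g (e h v)
        rw [map_mul]
        rfl }
  have hΓ : A4Graph.IsFullAut Γ :=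
    { adj_smul := fun g _ _ => (e g).map_adj_iff
      exists_smul := fun σ hσ =>
        ⟨e.symm ⟨σ, hσ _ _⟩, fun v => by
          change e (e.symm _) v = _
          rw [e.apply_symm_apply]
          rfl⟩ }
  intro v
  rw [Nat.card_coe_set_eq]
  exact ⟨hΓ.ncard_orbit_ne_four hV v, hΓ.ncard_orbit_ne_twelve hV v⟩
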